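/- The Sugawara operators on the bosonic Fock space close the Virasoro algebra with central charge c = 1: for all integers m and n, [Lₘ, Lₙ] = (m − n)·L_{m+n} + (1/12)·m·(m² − 1)·δ_{m+n,0}·id, as an identity of linear operators on F. -/

import Mathlib

/- Bosonic Fock space `F = ℝ[x₁, x₂, …]`, realized as `MvPolynomial ℕ ℝ`
(the variable `x₀` is never used: only indices `≥ 1` occur).
Heisenberg modes: `a₀ = λ·id`, `aₙ = n·∂/∂xₙ` and `a₋ₙ = (mult by xₙ)` for `n ≥ 1`. -/
noncomputable def heis (lam : ℝ) (n : ℤ) : Module.End ℝ (MvPolynomial ℕ ℝ) :=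
  if n = 0 then lam • (LinearMap.id : MvPolynomial ℕ ℝ →ₗ[ℝ] MvPolynomial ℕ ℝ)
  else if 0 < n then (n : ℝ) • (MvPolynomial.pderiv (R := ℝ) (n.toNat)).toLinearMap
  else LinearMap.mulLeft ℝ (MvPolynomial.X ((-n).toNat))

/- Normal ordering `:a_j a_k:` : the operator with positive index is placed to the
right (i.e. acts first) of the one with nonpositive index. -/
noncomputable def nord (lam : ℝ) (j k : ℤ) : Module.End ℝ (MvPolynomial ℕ ℝ) :=
  if j ≤ k then heis lam j ∘ₗ heis lam k else heis lam k ∘ₗ heis lam j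

/- Sugawara–Virasoro operators: `L₀ = Σ_{k>0} a₋ₖ aₖ + (1/2)a₀²` and, for `n ≠ 0`,
`Lₙ = (1/2) Σ_{m∈ℤ} :a_{n−m} aₘ:` (on each polynomial only finitely many summands
act nontrivially, so the `finsum` below is the actual sum). -/
noncomputable def Lop (lam : ℝ) (n : ℤ) (v : MvPolynomial ℕ ℝ) : MvPolynomial ℕ ℝ :=
  if n = 0 then
    (∑ᶠ k : {k : ℤ // 0 < k}, heis lam (-(k : ℤ)) (heis lam (k : ℤ) v))
      + (2⁻¹ : ℝ) • heis lam 0 (heis lam 0 v)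
  else (2⁻¹ : ℝ) • ∑ᶠ m : ℤ, nord lam (n - m) m v

theorem pderiv_comm {σ R : Type*} [CommSemiring R] (i j : σ) (p : MvPolynomial σ R) :
    MvPolynomial.pderiv i (MvPolynomial.pderiv j p)
      = MvPolynomial.pderiv j (MvPolynomial.pderiv i p) := by
  classical
  induction p using MvPolynomial.induction_on with
  | C a => simp
  | add p q hp hq => simp [hp, hq]
  | mul_X p k hp =>
    simp only [MvPolynomial.pderiv_mul, MvPolynomial.pderiv_X, Pi.single_apply, map_add, hp]
    split_ifs <;> simp [add_comm, add_left_comm]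

section Heisenberg

variable (lam : ℝ)

theorem heis_zero : heis lam 0 = lam • 1 := by
  simp [heis, Module.End.one_eq_id]

theorem heis_of_pos {n : ℤ} (hn : 0 < n) (v : MvPolynomial ℕ ℝ) :
    heis lam n v = (n : ℝ) • MvPolynomial.pderiv n.toNat v := by
  simp [heis, hn.ne', hn]

theorem heis_of_neg {n : ℤ} (hn : n < 0) (v : MvPolynomial ℕ ℝ) :
    heis lam n v = MvPolynomial.X (-n).toNat * v := by
  simp [heis, hn.ne, hn.not_gt]

/-- The canonical commutation relations of the Heisenberg modes. -/
theorem heis_mul_comm (j k : ℤ) :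
    heis lam j * heis lam k
      = heis lam k * heis lam j + (if j + k = 0 then (j : ℝ) else 0) • 1 := by
  have key : ∀ j k : ℤ, 0 < j → k < 0 → ∀ v, heis lam j (heis lam k v)
      = heis lam k (heis lam j v) + (if j + k = 0 then (j : ℝ) else 0) • v := by
    intro j k hj hk v
    rw [heis_of_pos lam hj, heis_of_neg lam hk, heis_of_pos lam hj, heis_of_neg lam hk,
      Derivation.leibniz, MvPolynomial.pderiv_X, smul_add]
    by_cases h : j + k = 0
    · have hjk : (-k).toNat = j.toNat := by lia
      simp [h, hjk]
    · have hjk : (-k).toNat ≠ j.toNat := by lia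
      simp [h, hjk]
  refine LinearMap.ext fun v => ?_
  change heis lam j (heis lam k v)
    = heis lam k (heis lam j v) + (if j + k = 0 then (j : ℝ) else 0) • v
  rcases lt_trichotomy j 0 with hj | rfl | hj
  · rcases lt_trichotomy k 0 with hk | rfl | hk
    · simp only [heis_of_neg lam hj, heis_of_neg lam hk]
      rw [if_neg (by lia)]
      simp only [zero_smul, add_zero]
      ring
    · simp [heis_zero, hj.ne]
    · rw [key k j hk hj]
      by_cases h : j + k = 0
      · have hkj : (k : ℝ) = -j := by
          have : k = -j := by lia
          simp [this]
        simp [h, add_comm k j, hkj]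
      · simp [h, add_comm k j]
  · simp [heis_zero]
  · rcases lt_trichotomy k 0 with hk | rfl | hk
    · exact key j k hj hk v
    · simp [heis_zero, hj.ne']
    · simp only [heis_of_pos lam hj, heis_of_pos lam hk]
      rw [if_neg (by lia)]
      simp only [Derivation.map_smul, zero_smul, add_zero]
      rw [smul_comm]
      congr 2
      exact pderiv_comm _ _ v

theorem exists_heis_apply_eq_zero (v : MvPolynomial ℕ ℝ) :
    ∃ N : ℤ, ∀ k, N ≤ k → heis lam k v = 0 := by
  refine ⟨(v.vars.sup id : ℕ) + 1, fun k hk => ?_⟩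
  rw [heis_of_pos lam (by lia), MvPolynomial.pderiv_eq_zero_of_notMem_vars, smul_zero]
  intro hmem
  have : k.toNat ≤ v.vars.sup id := Finset.le_sup (f := id) hmem
  lia

/-- A product of two modes differs from its normal ordering by a scalar. -/
theorem heis_mul_heis_eq_nord (j k : ℤ) :
    heis lam j * heis lam k
      = nord lam j k + (if j + k = 0 then (max j 0 : ℝ) else 0) • 1 := by
  unfold nord
  split_ifs with h h0 h0
  · have : (j : ℝ) ≤ 0 := by exact_mod_cast (by lia : j ≤ 0)
    simp [max_eq_right this, Module.End.mul_eq_comp]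
  · simp [Module.End.mul_eq_comp]
  · have : (0 : ℝ) ≤ j := by exact_mod_cast (by lia : 0 ≤ j)
    rw [heis_mul_comm, if_pos h0, max_eq_left this, Module.End.mul_eq_comp]
  · rw [heis_mul_comm, if_neg h0, Module.End.mul_eq_comp]

theorem nord_swap (j k : ℤ) : nord lam j k = nord lam k j := by
  unfold nord
  rcases lt_trichotomy j k with h | rfl | h
  · rw [if_pos h.le, if_neg h.not_ge]
  · rfl
  · rw [if_neg h.not_ge, if_pos h.le]

theorem nord_apply_eq_zero {N : ℤ} {v : MvPolynomial ℕ ℝ} (hN : ∀ k, N ≤ k → heis lam k v = 0)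
    {j k : ℤ} (h : N ≤ j ∨ N ≤ k) : nord lam j k v = 0 := by
  unfold nord
  split_ifs with hjk
  · simp [hN k (by lia)]
  · simp [hN j (by lia)]

theorem finite_support_nord (n : ℤ) (v : MvPolynomial ℕ ℝ) :
    (Function.support fun k : ℤ => nord lam (n - k) k v).Finite := by
  obtain ⟨N, hN⟩ := exists_heis_apply_eq_zero lam v
  refine (Set.finite_Ioo (n - N) N).subset fun k hk => ?_
  by_contra h
  refine hk (nord_apply_eq_zero lam hN ?_)
  simp only [Set.mem_Ioo, not_and_or, not_lt] at h
  lia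

theorem finite_support_smul_nord (c : ℤ → ℝ) (n : ℤ) (v : MvPolynomial ℕ ℝ) :
    (Function.support fun k : ℤ => c k • nord lam (n - k) k v).Finite :=
  (finite_support_nord lam n v).subset fun _ hk => right_ne_zero_of_smul hk

/-- The operators `Lₙ = (1/2) Σ_{m∈ℤ} :a_{n−m} aₘ:` as linear maps, uniformly in `n`. -/
noncomputable def sugawara (n : ℤ) : Module.End ℝ (MvPolynomial ℕ ℝ) where
  toFun v := (2⁻¹ : ℝ) • ∑ᶠ k : ℤ, nord lam (n - k) k v
  map_add' v w := by
    simp only [map_add]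
    rw [finsum_add_distrib (finite_support_nord lam n v) (finite_support_nord lam n w), smul_add]
  map_smul' c v := by
    simp only [map_smul, RingHom.id_apply]
    rw [← smul_finsum, smul_comm]

theorem sugawara_apply (n : ℤ) (v : MvPolynomial ℕ ℝ) :
    sugawara lam n v = (2⁻¹ : ℝ) • ∑ᶠ k : ℤ, nord lam (n - k) k v := rfl

theorem finsum_int_of_even {M : Type*} [AddCommMonoid M] {f : ℤ → M}
    (hf : (Function.support f).Finite) (heven : ∀ k, f (-k) = f k) :
    ∑ᶠ k, f k = 2 • (∑ᶠ k : {k : ℤ // 0 < k}, f k) + f 0 := by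
  classical
  let g : ℤ → M := fun k => if 0 < k then f k else 0
  have hg : (Function.support g).Finite := hf.subset fun k hk => by
    simp only [g, Function.mem_support] at hk ⊢
    aesop
  have hg' : (Function.support fun k => g (-k)).Finite :=
    hg.preimage (f := fun k : ℤ => -k) neg_injective.injOn
  have h0 : (Function.support fun k : ℤ => if k = 0 then f 0 else 0).Finite :=
    (Set.finite_singleton (0 : ℤ)).subset fun k hk => by
      simp only [Function.mem_support] at hk
      aesop
  have hsplit : ∀ k, f k = g k + g (-k) + if k = 0 then f 0 else 0 := by
    intro k
    rcases lt_trichotomy k 0 with hk | rfl | hk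
    · simp [g, hk, hk.ne, hk.not_gt, heven]
    · simp [g]
    · simp [g, hk, hk.ne', hk.not_gt]
  have hsub : ∑ᶠ k : {k : ℤ // 0 < k}, f k = ∑ᶠ k, g k := by
    rw [finsum_subtype_eq_finsum_cond]
    refine finsum_congr fun k => ?_
    by_cases hk : 0 < k <;> simp [g, hk]
  have hneg : ∑ᶠ k, g (-k) = ∑ᶠ k, g k := finsum_comp_equiv (Equiv.neg ℤ)
  have hzero : (∑ᶠ k : ℤ, if k = 0 then f 0 else 0) = f 0 := by
    rw [finsum_eq_single _ 0 (fun k hk => if_neg hk), if_pos rfl]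
  have hgg : (Function.support fun k => g k + g (-k)).Finite :=
    (hg.union hg').subset (Function.support_add _ _)
  rw [finsum_congr hsplit, finsum_add_distrib hgg h0, finsum_add_distrib hg hg', hneg, hzero,
    hsub, two_nsmul]

theorem Lop_eq_sugawara (n : ℤ) (v : MvPolynomial ℕ ℝ) : Lop lam n v = sugawara lam n v := by
  rw [sugawara_apply, Lop]
  split_ifs with hn
  · subst hn
    rw [finsum_int_of_even (finite_support_nord lam 0 v)
      fun k => by rw [nord_swap]; simp]
    have hk : ∀ k : {k : ℤ // 0 < k}, nord lam (0 - k) k v = heis lam (-k) (heis lam k v) := by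
      rintro ⟨k, hk⟩
      rw [nord, if_pos (by simp only; lia), zero_sub, LinearMap.comp_apply]
    rw [finsum_congr hk, smul_add, ← Nat.cast_smul_eq_nsmul ℝ, smul_smul]
    simp [nord]
  · rfl

/-- `[:a_i a_j:, a_k]` is given by the Leibniz rule. -/
theorem nord_mul_heis (i j k : ℤ) :
    nord lam i j * heis lam k = heis lam k * nord lam i j
      + ((if j + k = 0 then (j : ℝ) else 0) • heis lam i
        + (if i + k = 0 then (i : ℝ) else 0) • heis lam j) := by
  have h := heis_mul_heis_eq_nord lam i j
  replace h := eq_sub_of_add_eq h.symm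
  rw [h, sub_mul, mul_sub, mul_assoc, heis_mul_comm lam j k, mul_add, ← mul_assoc,
    heis_mul_comm lam i k]
  simp only [add_mul, mul_smul_comm, smul_mul_assoc, mul_one, one_mul, mul_assoc]
  abel

/-- The modes are primary of weight one: `[Lₘ, aₖ] = -k a_{m+k}`. -/
theorem sugawara_mul_heis (m k : ℤ) :
    sugawara lam m * heis lam k
      = heis lam k * sugawara lam m - (k : ℝ) • heis lam (m + k) := by
  refine LinearMap.ext fun v => ?_
  change sugawara lam m (heis lam k v)
    = heis lam k (sugawara lam m v) - (k : ℝ) • heis lam (m + k) v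
  rw [sugawara_apply, sugawara_apply, map_smul]
  have hcomm : ∀ j, nord lam (m - j) j (heis lam k v)
      = heis lam k (nord lam (m - j) j v)
        + ((if j + k = 0 then (j : ℝ) else 0) • heis lam (m - j) v
          + (if m - j + k = 0 then ((m - j : ℤ) : ℝ) else 0) • heis lam j v) := fun j =>
    LinearMap.congr_fun (nord_mul_heis lam (m - j) j k) v
  have h₁ : (Function.support fun j => heis lam k (nord lam (m - j) j v)).Finite :=
    (finite_support_nord lam m v).subset
      (Function.support_comp_subset (map_zero (heis lam k)) _)
  have h₂ : (Function.support fun j : ℤ =>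
      (if j + k = 0 then (j : ℝ) else 0) • heis lam (m - j) v).Finite :=
    (Set.finite_singleton (-k)).subset fun j hj => by
      by_contra h
      exact hj (by simp [show j + k ≠ 0 from fun h' => h (by simp; lia)])
  have h₃ : (Function.support fun j : ℤ =>
      (if m - j + k = 0 then ((m - j : ℤ) : ℝ) else 0) • heis lam j v).Finite :=
    (Set.finite_singleton (m + k)).subset fun j hj => by
      by_contra h
      refine hj ?_
      simp only
      rw [if_neg (show m - j + k ≠ 0 from fun h' => h (by simp; lia)), zero_smul]
  have hmap : ∑ᶠ j, heis lam k (nord lam (m - j) j v)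
      = heis lam k (∑ᶠ j, nord lam (m - j) j v) :=
    ((heis lam k).toAddMonoidHom.map_finsum (finite_support_nord lam m v)).symm
  have hs₁ : ∑ᶠ j : ℤ, (if j + k = 0 then (j : ℝ) else 0) • heis lam (m - j) v
      = (-k : ℝ) • heis lam (m + k) v := by
    rw [finsum_eq_single _ (-k) fun j hj => by rw [if_neg (by lia), zero_smul],
      if_pos (by lia), sub_neg_eq_add, Int.cast_neg]
  have hs₂ : ∑ᶠ j : ℤ, (if m - j + k = 0 then ((m - j : ℤ) : ℝ) else 0) • heis lam j v
      = (-k : ℝ) • heis lam (m + k) v := by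
    rw [finsum_eq_single _ (m + k) fun j hj => by rw [if_neg (by lia), zero_smul],
      if_pos (by lia), show m - (m + k) = -k by lia, Int.cast_neg]
  rw [finsum_congr hcomm, finsum_add_distrib h₁
    ((h₂.union h₃).subset (Function.support_add _ _)), finsum_add_distrib h₂ h₃, hmap,
    hs₁, hs₂]
  module

theorem finite_support_central (m : ℤ) :
    (Function.support fun k : ℤ => (m + k : ℝ) * max (-k : ℝ) 0
      - k * max (-(m + k) : ℝ) 0).Finite := by
  refine (Set.finite_Icc (-|m|) |m|).subset fun k hk => ?_
  by_contra h
  refine hk ?_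
  have hk' : (0 < k ∧ 0 < m + k) ∨ (k < 0 ∧ m + k < 0) := by
    rw [Set.mem_Icc] at h
    rcases abs_cases m with h' | h' <;> lia
  rcases hk' with ⟨h₁, h₂⟩ | ⟨h₁, h₂⟩
  · have h₁' : (-k : ℝ) ≤ 0 := by exact_mod_cast (by lia : -k ≤ 0)
    have h₂' : (-(m + k) : ℝ) ≤ 0 := by exact_mod_cast (by lia : -(m + k) ≤ 0)
    simp only [max_eq_right h₁', max_eq_right h₂']
    ring
  · have h₁' : (0 : ℝ) ≤ -k := by exact_mod_cast (by lia : 0 ≤ -k)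
    have h₂' : (0 : ℝ) ≤ -(m + k) := by exact_mod_cast (by lia : 0 ≤ -(m + k))
    simp only [max_eq_left h₁', max_eq_left h₂']
    ring

theorem sum_range_mul_sub (a : ℝ) (M : ℕ) :
    ∑ j ∈ Finset.range (M + 1), (a - j) * j
      = a * (M * (M + 1) / 2) - M * (M + 1) * (2 * M + 1) / 6 := by
  induction M with
  | zero => simp
  | succ M ih =>
    rw [Finset.sum_range_succ, ih]
    push_cast
    ring

theorem finsum_central_natCast (M : ℕ) :
    ∑ᶠ k : ℤ, ((M + k : ℝ) * max (-k : ℝ) 0 - k * max (-(M + k) : ℝ) 0)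
      = M * (M ^ 2 - 1) / 6 := by
  rw [← finsum_comp_equiv (Equiv.neg ℤ), finsum_eq_sum_of_support_subset
    (s := (Finset.range (M + 1)).map Nat.castEmbedding), Finset.sum_map]
  · have hterm : ∀ j ∈ Finset.range (M + 1),
        ((M + ((Equiv.neg ℤ (Nat.castEmbedding j) : ℤ) : ℝ))
            * max (-((Equiv.neg ℤ (Nat.castEmbedding j) : ℤ) : ℝ)) 0
          - ((Equiv.neg ℤ (Nat.castEmbedding j) : ℤ) : ℝ)
            * max (-(M + ((Equiv.neg ℤ (Nat.castEmbedding j) : ℤ) : ℝ))) 0)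
          = ((M : ℝ) - j) * j := by
      intro j hj
      have hj' : (j : ℝ) ≤ M := by exact_mod_cast Finset.mem_range_succ_iff.mp hj
      have h₁ : max (- -(j : ℝ)) 0 = j := by simp
      have h₂ : max (-((M : ℝ) + -j)) 0 = 0 := max_eq_right (by linarith)
      simp only [Equiv.neg_apply, Nat.castEmbedding_apply, Int.cast_neg, Int.cast_natCast, h₁, h₂]
      ring
    rw [Finset.sum_congr rfl hterm, sum_range_mul_sub]
    ring
  · intro k hk
    by_contra h
    refine hk ?_
    have hk' : k < 0 ∨ (M : ℤ) < k := by
      by_contra! h'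
      refine h ?_
      simp only [Finset.coe_map, Set.mem_image, Finset.mem_coe, Finset.mem_range]
      exact ⟨k.toNat, by lia, by simp [h'.1]⟩
    simp only [Equiv.neg_apply, Int.cast_neg, neg_neg]
    rcases hk' with h' | h'
    · have h₁ : (k : ℝ) ≤ 0 := by exact_mod_cast h'.le
      have h₂ : -((M : ℝ) + -k) ≤ 0 := by
        have : (0 : ℝ) ≤ M := M.cast_nonneg
        linarith
      rw [max_eq_right h₁, max_eq_right h₂]
      ring
    · have h₂ : (M : ℝ) < k := by exact_mod_cast h'
      have h₁ : (0 : ℝ) ≤ M := M.cast_nonneg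
      rw [max_eq_left (h₁.trans h₂.le), max_eq_left (by linarith)]
      ring

theorem finsum_central (m : ℤ) :
    ∑ᶠ k : ℤ, ((m + k : ℝ) * max (-k : ℝ) 0 - k * max (-(m + k) : ℝ) 0)
      = m * (m ^ 2 - 1) / 6 := by
  obtain ⟨M, rfl | rfl⟩ := m.eq_nat_or_neg
  · simpa using finsum_central_natCast M
  · rw [← finsum_comp_equiv (Equiv.addRight (M : ℤ))]
    have h : ∀ k : ℤ,
        ((((-M : ℤ) : ℝ) + (Equiv.addRight (M : ℤ) k : ℤ))
            * max (-((Equiv.addRight (M : ℤ) k : ℤ) : ℝ)) 0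
          - (Equiv.addRight (M : ℤ) k : ℤ)
            * max (-(((-M : ℤ) : ℝ) + (Equiv.addRight (M : ℤ) k : ℤ))) 0)
          = -((M + k : ℝ) * max (-k : ℝ) 0 - k * max (-(M + k) : ℝ) 0) := by
      intro k
      simp only [Equiv.coe_addRight, Int.cast_add, Int.cast_neg, Int.cast_natCast]
      rw [show -(M : ℝ) + (k + M) = k by ring, show (k : ℝ) + M = M + k by ring]
      ring
    rw [finsum_congr h, finsum_neg_distrib, finsum_central_natCast]
    push_cast
    ring

/-- The commutator of `Lₘ` with the normal ordered product `:a_{n-k} aₖ:`. -/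
theorem sugawara_mul_nord (m n k : ℤ) :
    sugawara lam m * nord lam (n - k) k = nord lam (n - k) k * sugawara lam m
      + ((k - n : ℝ) • nord lam (m + n - k) k - (k : ℝ) • nord lam (n - k) (m + k)
        + (if m + n = 0 then ((m + k : ℝ) * max (-k : ℝ) 0 - k * max (-(m + k) : ℝ) 0)
          else 0) • 1) := by
  have h := heis_mul_heis_eq_nord lam (n - k) k
  replace h := eq_sub_of_add_eq h.symm
  have hprod : sugawara lam m * (heis lam (n - k) * heis lam k)
      = heis lam (n - k) * heis lam k * sugawara lam m
        + ((k - n : ℝ) • (heis lam (m + n - k) * heis lam k)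
          - (k : ℝ) • (heis lam (n - k) * heis lam (m + k))) := by
    rw [← mul_assoc, sugawara_mul_heis, sub_mul, mul_assoc, sugawara_mul_heis, mul_sub,
      smul_mul_assoc, mul_smul_comm, ← mul_assoc, show m + (n - k) = m + n - k by ring]
    push_cast
    module
  rw [h, mul_sub, sub_mul, hprod, heis_mul_heis_eq_nord lam (m + n - k) k,
    heis_mul_heis_eq_nord lam (n - k) (m + k), show m + n - k + k = m + n by ring,
    show n - k + (m + k) = m + n by ring]
  by_cases hmn : m + n = 0
  · have hn : (n : ℝ) = -m := by
      have : n = -m := by lia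
      simp [this]
    simp only [hmn, if_true, mul_smul_comm, smul_mul_assoc, mul_one, one_mul]
    push_cast
    rw [hn, show (-m - k : ℝ) = -(m + k) by ring]
    simp only [zero_sub]
    module
  · simp only [hmn, if_false, mul_smul_comm, smul_mul_assoc, mul_one, one_mul, zero_smul, add_zero]
    abel

theorem finsum_smul_nord_shift (m n : ℤ) (v : MvPolynomial ℕ ℝ) :
    ∑ᶠ k : ℤ, (k : ℝ) • nord lam (n - k) (m + k) v
      = ∑ᶠ k : ℤ, (k - m : ℝ) • nord lam (m + n - k) k v := by
  rw [← finsum_comp_equiv (Equiv.addLeft m) (f := fun k : ℤ =>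
    (k - m : ℝ) • nord lam (m + n - k) k v)]
  refine finsum_congr fun k => ?_
  simp only [Equiv.coe_addLeft, Int.cast_add]
  rw [add_sub_cancel_left, show m + n - (m + k) = n - k by ring]

theorem finite_support_smul_nord_shift (m n : ℤ) (v : MvPolynomial ℕ ℝ) :
    (Function.support fun k : ℤ => (k : ℝ) • nord lam (n - k) (m + k) v).Finite := by
  refine ((finite_support_nord lam (m + n) v).preimage
    (f := fun k => m + k) (add_right_injective m).injOn).subset fun k hk => ?_
  simp only [Set.mem_preimage, Function.mem_support] at hk ⊢
  rw [show m + n - (m + k) = n - k by ring]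
  exact right_ne_zero_of_smul hk

theorem finsum_sugawara_commutator (m n : ℤ) (v : MvPolynomial ℕ ℝ) :
    ∑ᶠ k : ℤ, ((k - n : ℝ) • nord lam (m + n - k) k v - (k : ℝ) • nord lam (n - k) (m + k) v)
      = (m - n : ℝ) • ∑ᶠ k : ℤ, nord lam (m + n - k) k v := by
  rw [finsum_sub_distrib (finite_support_smul_nord lam (fun k => k - n) (m + n) v)
    (finite_support_smul_nord_shift lam m n v), finsum_smul_nord_shift,
    ← finsum_sub_distrib (finite_support_smul_nord lam (fun k => k - n) (m + n) v)
      (finite_support_smul_nord lam (fun k => k - m) (m + n) v), smul_finsum]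
  exact finsum_congr fun k => by module

end Heisenberg

/-- The Sugawara operators on the bosonic Fock space close the Virasoro algebra with
central charge `c = 1`: for all integers `m` and `n`,
`[Lₘ, Lₙ] = (m − n)·L_{m+n} + (1/12)·m·(m² − 1)·δ_{m+n,0}·id`,
as an identity of linear operators on `F`. -/
theorem statement2 (lam : ℝ) (m n : ℤ) :
    ∀ v : MvPolynomial ℕ ℝ,
      Lop lam m (Lop lam n v) - Lop lam n (Lop lam m v)
        = ((m : ℝ) - (n : ℝ)) • Lop lam (m + n) v
          + ((1 / 12 : ℝ) * (m : ℝ) * ((m : ℝ) ^ 2 - 1)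
              * (if m + n = 0 then (1 : ℝ) else 0)) • v := by
  intro v
  have hc : (Function.support fun k : ℤ =>
      (if m + n = 0 then ((m + k : ℝ) * max (-k : ℝ) 0 - k * max (-(m + k) : ℝ) 0)
        else 0) • v).Finite := by
    split_ifs
    · exact (finite_support_central m).subset fun _ hk => left_ne_zero_of_smul hk
    · simp
  have hd : (Function.support fun k : ℤ => (k - n : ℝ) • nord lam (m + n - k) k v
      - (k : ℝ) • nord lam (n - k) (m + k) v).Finite :=
    ((finite_support_smul_nord lam (fun k => k - n) (m + n) v).union
      (finite_support_smul_nord_shift lam m n v)).subset (Function.support_sub _ _)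
  have hcomm : ∀ k : ℤ, sugawara lam m (nord lam (n - k) k v)
      = nord lam (n - k) k (sugawara lam m v)
        + (((k - n : ℝ) • nord lam (m + n - k) k v - (k : ℝ) • nord lam (n - k) (m + k) v)
          + (if m + n = 0 then ((m + k : ℝ) * max (-k : ℝ) 0 - k * max (-(m + k) : ℝ) 0)
            else 0) • v) := fun k =>
    LinearMap.congr_fun (sugawara_mul_nord lam m n k) v
  have hmap : sugawara lam m (∑ᶠ k : ℤ, nord lam (n - k) k v)
      = ∑ᶠ k : ℤ, sugawara lam m (nord lam (n - k) k v) :=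
    (sugawara lam m).toAddMonoidHom.map_finsum (finite_support_nord lam n v)
  have hcentral : ∑ᶠ k : ℤ,
      (if m + n = 0 then ((m + k : ℝ) * max (-k : ℝ) 0 - k * max (-(m + k) : ℝ) 0)
        else 0) • v = ((m * (m ^ 2 - 1) / 6 : ℝ) * if m + n = 0 then 1 else 0) • v := by
    rw [← finsum_smul]
    split_ifs
    · rw [finsum_central, mul_one]
    · simp
  simp only [Lop_eq_sugawara]
  rw [sugawara_apply lam n v, map_smul, hmap, finsum_congr hcomm,
    finsum_add_distrib (finite_support_nord lam n _)
      ((hd.union hc).subset (Function.support_add _ _)),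
    finsum_add_distrib hd hc, finsum_sugawara_commutator, hcentral,
    sugawara_apply lam n (sugawara lam m v), sugawara_apply lam (m + n) v]
  module
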